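/- Let m ≥ 1 and suppose (α, {δ_i}_{i=0}^m) represents a minimal norm pair (a, d) = ((a_0,…,a_{m-1}), d) of length m. Then for every 0 ≤ i < m with a_i ≠ -∞, the cyclic F_p[G]-submodule of J_1 generated by [δ_i]_1 is a free F_p[G_{a_i}]-module (i.e., it is isomorphic to F_p[G_{a_i}] as an F_p[G_{a_i}]-module). -/

import Mathlib

/-!
Common setup.  Throughout, `K/F` is a cyclic Galois extension of degree `p^n`
with Galois group `G = Gal(K/F)` generated by `σ`.  For `0 ≤ i ≤ n`, `K_i`
denotes the intermediate field of degree `p^i` over `F`, realized here via its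
unit group `KiU p σ i` (the units of `K` fixed by `σ^{p^i}`), and
`G_i = Gal(K_i/F)`.  For `m ≥ 1`, `R_m = ℤ/p^m` and `J_m = K^×/K^{×p^m}`.
-/

namespace MSS

variable {F K : Type*} [Field F] [Field K] [Algebra F K]

/-- Action of a field automorphism on the unit group. -/
def umap (σ : K ≃ₐ[F] K) : Kˣ →* Kˣ := Units.map (σ : K →* K)

/-- The norm from `K_j` to `F`, computed in `K` as the product of conjugates
`∏_{k < p^j} σ^k(γ)` (valid for `γ ∈ K_j`). -/
noncomputable def normHom (p : ℕ) (σ : K ≃ₐ[F] K) (j : ℕ) : Kˣ →* Kˣ :=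
  ∏ k ∈ Finset.range (p ^ j), umap (σ ^ k)

/-- The unit group of the intermediate field `K_i`: the units fixed by `σ^{p^i}`. -/
def KiU (p : ℕ) (σ : K ≃ₐ[F] K) (i : ℕ) : Subgroup Kˣ :=
  (umap (σ ^ p ^ i) / MonoidHom.id Kˣ).ker

/-- Membership in `K_a^×` for a level `a ∈ {-∞, 0, 1, …}`; level `-∞` means
the trivial group `{1}`. -/
def levelMem (p : ℕ) (σ : K ≃ₐ[F] K) (a : WithBot ℕ) (γ : Kˣ) : Prop :=
  WithBot.recBotCoe (γ = 1) (fun i => γ ∈ KiU p σ i) a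

/-- `(α, δ)` represents the pair `(a, d)`:  `σ(α)·α^{-d} = ∏_{i=0}^m δ_i^{p^i}` with
`δ_i ∈ K_{a_i}^×` for `i < m`, and
`ξ_p = N_{K/F}(α)^{(d-1)/p} · N_{K_{n-1}/F}(δ_0) · ∏_{i=1}^m N_{K/F}(δ_i)^{p^{i-1}}`. -/
noncomputable def Represents (p n : ℕ) (σ : K ≃ₐ[F] K) (ξ : Kˣ) {m : ℕ}
    (a : Fin m → WithBot ℕ) (d : ℤ) (α : Kˣ) (δ : ℕ → Kˣ) : Prop :=
  (∀ i : Fin m, levelMem p σ (a i) (δ i)) ∧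
  umap σ α = α ^ d * ∏ i ∈ Finset.range (m + 1), δ i ^ p ^ i ∧
  ξ = normHom p σ n α ^ ((d - 1) / (p : ℤ)) * normHom p σ (n - 1) (δ 0) *
      ∏ i ∈ Finset.Icc 1 m, normHom p σ n (δ i) ^ p ^ (i - 1)

/-- `(a, d)` is a norm pair of length `m`: `a ∈ {-∞,0,…,n}^m` with `a_0 < n`,
`d ∈ U_1`, and some `(α, δ)` represents `(a, d)`. -/
noncomputable def IsNormPair (p n : ℕ) (σ : K ≃ₐ[F] K) (ξ : Kˣ) {m : ℕ}
    (a : Fin m → WithBot ℕ) (d : ℤ) : Prop :=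
  (∀ i, a i ≤ (n : WithBot ℕ)) ∧
  (∀ h0 : 0 < m, a ⟨0, h0⟩ < (n : WithBot ℕ)) ∧
  (p : ℤ) ∣ d - 1 ∧
  ∃ (α : Kˣ) (δ : ℕ → Kˣ), Represents p n σ ξ a d α δ

/-- Strict lexicographic order on norm vectors (with `-∞` smallest). -/
def vecLT {m : ℕ} (a a' : Fin m → WithBot ℕ) : Prop :=
  ∃ k : Fin m, (∀ j : Fin m, j < k → a j = a' j) ∧ a k < a' k

/-- The order `d ≤_m d'` on twists: `d' ∈ U_i → d ∈ U_i` for `1 ≤ i ≤ m`, except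
when `p = 2` and `d, d' ∉ U_2`, in which case `d' ∈ -U_i → d ∈ -U_i` for `2 ≤ i ≤ m`. -/
def twistLE (p m : ℕ) (d d' : ℤ) : Prop :=
  ((p = 2 ∧ ¬ (4 : ℤ) ∣ (d - 1) ∧ ¬ (4 : ℤ) ∣ (d' - 1)) →
    ∀ i : ℕ, 2 ≤ i → i ≤ m → ((2 : ℤ) ^ i ∣ (d' + 1)) → ((2 : ℤ) ^ i ∣ (d + 1))) ∧
  (¬ (p = 2 ∧ ¬ (4 : ℤ) ∣ (d - 1) ∧ ¬ (4 : ℤ) ∣ (d' - 1)) →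
    ∀ i : ℕ, 1 ≤ i → i ≤ m → ((p : ℤ) ^ i ∣ (d' - 1)) → ((p : ℤ) ^ i ∣ (d - 1)))

/-- The order `⪯_m` on norm pairs of length `m`. -/
def pairLE (p : ℕ) {m : ℕ} (a : Fin m → WithBot ℕ) (d : ℤ)
    (a' : Fin m → WithBot ℕ) (d' : ℤ) : Prop :=
  vecLT a a' ∨ (a = a' ∧ twistLE p m d d')

/-- `(a, d)` is a minimal norm pair of length `m`. -/
noncomputable def IsMinimalNormPair (p n : ℕ) (σ : K ≃ₐ[F] K) (ξ : Kˣ) {m : ℕ}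
    (a : Fin m → WithBot ℕ) (d : ℤ) : Prop :=
  IsNormPair p n σ ξ a d ∧
  ∀ (a' : Fin m → WithBot ℕ) (d' : ℤ), IsNormPair p n σ ξ a' d' → pairLE p a d a' d'

/-- `α` is an `m`-exceptional element. -/
noncomputable def IsExceptional (p n : ℕ) (σ : K ≃ₐ[F] K) (ξ : Kˣ) (m : ℕ) (α : Kˣ) : Prop :=
  ∃ (a : Fin m → WithBot ℕ) (d : ℤ) (δ : ℕ → Kˣ),
    IsMinimalNormPair p n σ ξ a d ∧ Represents p n σ ξ a d α δ

/-- The subgroup of `q`-th powers in `K^×`. -/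
def powSub (K : Type*) [Field K] (q : ℕ) : Subgroup Kˣ := (powMonoidHom q : Kˣ →* Kˣ).range

/-- The class of a unit in `J_q := K^×/K^{×q}`. -/
def jcls (q : ℕ) (γ : Kˣ) : Kˣ ⧸ powSub K q := QuotientGroup.mk γ

/-- The action of a field automorphism on `J_q = K^×/K^{×q}`. -/
noncomputable def jmap (q : ℕ) (τ : K ≃ₐ[F] K) : (Kˣ ⧸ powSub K q) →* Kˣ ⧸ powSub K q :=
  QuotientGroup.map _ _ (umap τ) (by
    rintro x ⟨y, rfl⟩
    exact ⟨umap τ y, by simp [powMonoidHom, map_pow]⟩)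

/-- The natural map `J_q → J_{q'}` when `q' ∣ q`. -/
noncomputable def resMap (q q' : ℕ) (h : q' ∣ q) : (Kˣ ⧸ powSub K q) →* Kˣ ⧸ powSub K q' :=
  QuotientGroup.map _ _ (MonoidHom.id Kˣ) (by
    rintro x ⟨y, rfl⟩
    obtain ⟨c, rfl⟩ := h
    exact ⟨y ^ c, by simp [powMonoidHom, ← pow_mul, mul_comm]⟩)

/-- The `R_m[G]`-submodule of `J_q` generated by the classes of the elements of `S`:
the subgroup generated by all `σ^k`-conjugates of classes of elements of `S`. -/
noncomputable def galSpan (q : ℕ) (σ : K ≃ₐ[F] K) (S : Set Kˣ) : Subgroup (Kˣ ⧸ powSub K q) :=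
  Subgroup.closure {x | ∃ γ ∈ S, ∃ k : ℕ, x = jcls q (umap (σ ^ k) γ)}

/-- The subgroup `(σ-1)J_q` of `J_q`. -/
noncomputable def augSub (q : ℕ) (σ : K ≃ₐ[F] K) : Subgroup (Kˣ ⧸ powSub K q) :=
  Subgroup.closure {x | ∃ y : Kˣ ⧸ powSub K q, x = jmap q σ y * y⁻¹}

/-- The cyclic `F_p[G]`-submodule of `J_1 = K^×/K^{×p}` generated by `[γ]_1` is a
free `F_p[G_i]`-module (on the generator `[γ]_1`): `[γ]_1` is fixed by `σ^{p^i}`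
and the conjugates `σ^k [γ]_1`, `k < p^i`, are `F_p`-linearly independent. -/
noncomputable def FreeCyc (p : ℕ) (σ : K ≃ₐ[F] K) (i : ℕ) (γ : Kˣ) : Prop :=
  jcls p (umap (σ ^ p ^ i) γ) = jcls p γ ∧
  ∀ c : Fin (p ^ i) → ZMod p,
    (∏ k : Fin (p ^ i), jcls p (umap (σ ^ (k : ℕ)) γ) ^ (c k).val) = 1 → c = 0

/-- An (indexed) internal direct sum decomposition of a commutative group. -/
def IsDirectSumDecomp {G : Type*} [CommGroup G] {ι : Sort*} (f : ι → Subgroup G) : Prop :=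
  iSupIndep f ∧ (⨆ i, f i) = ⊤

/-- The subgroup `F^×` of `K^×` (units coming from the base field). -/
def Funits (F : Type*) {K : Type*} [Field F] [Field K] [Algebra F K] : Subgroup Kˣ :=
  (Units.map (algebraMap F K : F →* K)).range

/-- The subgroup `F^{×p}` of `K^×`. -/
def FpPow (F : Type*) {K : Type*} [Field F] [Field K] [Algebra F K] (p : ℕ) : Subgroup Kˣ :=
  (Funits F).map (powMonoidHom p)

/-- The subgroup `N_{K_i/F}(K_i^×)` of `K^×`. -/
noncomputable def NormSub (p : ℕ) (σ : K ≃ₐ[F] K) (i : ℕ) : Subgroup Kˣ :=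
  (KiU p σ i).map (normHom p σ i)

/-- The subgroup `N_{K_i/F}(K_i^×)·F^{×p}` of `K^×`. -/
noncomputable def NiF (p : ℕ) (σ : K ≃ₐ[F] K) (i : ℕ) : Subgroup Kˣ :=
  NormSub p σ i ⊔ FpPow F p

/-- The `F_p`-dimension of an (elementary abelian `p`-) commutative group `Q`,
computed as the rank of `F_p ⊗_ℤ Q`. -/
noncomputable def fpdim (p : ℕ) (Q : Type*) [CommGroup Q] : Cardinal :=
  Module.rank (ZMod p) (TensorProduct ℤ (ZMod p) (Additive Q))

/-- The invariant `e_i(K/F)`: for `i < n` the `F_p`-dimension of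
`N_{K_i/F}(K_i^×)F^{×p} / N_{K_{i+1}/F}(K_{i+1}^×)F^{×p}`, and for `i = n` the
`F_p`-dimension of `N_{K/F}(K^×)F^{×p}/F^{×p}`. -/
noncomputable def eKF (p n : ℕ) (σ : K ≃ₐ[F] K) (i : ℕ) : Cardinal :=
  if i < n then
    fpdim p ((NiF p σ i) ⧸ (NiF p σ (i + 1)).subgroupOf (NiF p σ i))
  else
    fpdim p ((NiF p σ n) ⧸ (FpPow F p).subgroupOf (NiF p σ n))

/-- The group ring `R_m[G_i] = (ℤ/p^m)[ℤ/p^i]` (for the cyclic group `G_i` of order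
`p^i`). -/
abbrev CycGR (p m i : ℕ) : Type :=
  MonoidAlgebra (ZMod (p ^ m)) (Multiplicative (ZMod (p ^ i)))

/-- The image of the generator `σ` of `G_i` in the group ring `R_m[G_i]`. -/
noncomputable def gen (p m i : ℕ) : CycGR p m i :=
  MonoidAlgebra.of _ _ (Multiplicative.ofAdd (1 : ZMod (p ^ i)))

/-- Standard basis vector of the free `R_m[G]`-module on generators `e_0, …, e_m`. -/
noncomputable def sing (p n m : ℕ) (j : Fin (m + 1)) (c : CycGR p m n) :
    Fin (m + 1) → CycGR p m n :=
  Pi.single j c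

/-- The relations defining the module `X_{a,d,m}`: on generators `y = e_0` and
`x_i = e_{i+1}` (`0 ≤ i < m`), we impose `(σ - d)·y = Σ_i p^i x_i`, and
`(σ^{p^{a_i}} - 1)·x_i = 0` when `a_i ≠ -∞`, resp. `x_i = 0` when `a_i = -∞`. -/
noncomputable def XRels (p n m : ℕ) (a : Fin m → WithBot ℕ) (d : ℤ) :
    Set (Fin (m + 1) → CycGR p m n) :=
  insert
    (sing p n m 0 (gen p m n - (d : ZMod (p ^ m)) • 1) -
      ∑ i : Fin m, sing p n m i.succ ((p : CycGR p m n) ^ (i : ℕ)))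
    {r | ∃ i : Fin m, r = sing p n m i.succ
      (WithBot.recBotCoe (1 : CycGR p m n) (fun k => gen p m n ^ p ^ k - 1) (a i))}

/-- The `R_m[G]`-module `X_{a,d,m}`. -/
noncomputable abbrev Xadm (p n m : ℕ) (a : Fin m → WithBot ℕ) (d : ℤ) :=
  (Fin (m + 1) → CycGR p m n) ⧸ Submodule.span (CycGR p m n) (XRels p n m a d)

/-- Indecomposability of a module. -/
def IsIndecomposable (R M : Type*) [Ring R] [AddCommGroup M] [Module R M] : Prop :=
  (⊤ : Submodule R M) ≠ ⊥ ∧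
  ∀ S T : Submodule R M, S ⊓ T = ⊥ → S ⊔ T = ⊤ → S = ⊥ ∨ T = ⊥

end MSS

namespace MSS

section Norms

variable {F K : Type*} [Field F] [Field K] [Algebra F K]

@[simp]
theorem umap_one (x : Kˣ) : umap (1 : K ≃ₐ[F] K) x = x := by
  ext; rfl

theorem umap_mul (σ τ : K ≃ₐ[F] K) (x : Kˣ) : umap (σ * τ) x = umap σ (umap τ x) := by
  ext; rfl

theorem umap_comm {σ τ : K ≃ₐ[F] K} (h : Commute σ τ) (x : Kˣ) :
    umap σ (umap τ x) = umap τ (umap σ x) := by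
  rw [← umap_mul, h.eq, umap_mul]

theorem mem_KiU {p i : ℕ} {σ : K ≃ₐ[F] K} {x : Kˣ} :
    x ∈ KiU p σ i ↔ umap (σ ^ p ^ i) x = x := by
  simp [KiU, MonoidHom.mem_ker, div_eq_one]

theorem umap_pow_eq_zeta {σ : K ≃ₐ[F] K} {ζ x : Kˣ} (hζ : umap σ ζ = ζ)
    (h : umap σ x = ζ * x) (j : ℕ) : umap (σ ^ j) x = ζ ^ j * x := by
  induction j with
  | zero => simp
  | succ j ih => rw [pow_succ', umap_mul, ih, map_mul, map_pow, hζ, h, pow_succ, mul_assoc]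

theorem umap_pow_eq_self {σ : K ≃ₐ[F] K} {x : Kˣ} (h : umap σ x = x) (j : ℕ) :
    umap (σ ^ j) x = x := by
  simpa using umap_pow_eq_zeta (ζ := 1) (map_one _) (by simpa using h) j

theorem KiU_mono {p i j : ℕ} (h : i ≤ j) (σ : K ≃ₐ[F] K) : KiU p σ i ≤ KiU p σ j := by
  intro x hx
  rw [mem_KiU] at hx ⊢
  obtain ⟨t, rfl⟩ := Nat.exists_eq_add_of_le h
  rw [pow_add, pow_mul]
  exact umap_pow_eq_self hx _

/-- The product of the first `q` conjugates under the powers of `ρ`. -/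
noncomputable def partialNorm (ρ : K ≃ₐ[F] K) (q : ℕ) : Kˣ →* Kˣ :=
  ∏ k ∈ Finset.range q, umap (ρ ^ k)

theorem partialNorm_apply (ρ : K ≃ₐ[F] K) (q : ℕ) (x : Kˣ) :
    partialNorm ρ q x = ∏ k ∈ Finset.range q, umap (ρ ^ k) x := by
  simp [partialNorm, MonoidHom.finsetProd_apply]

theorem normHom_eq_partialNorm (p : ℕ) (σ : K ≃ₐ[F] K) (j : ℕ) :
    normHom p σ j = partialNorm σ (p ^ j) := rfl

theorem partialNorm_succ (ρ : K ≃ₐ[F] K) (q : ℕ) (x : Kˣ) :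
    partialNorm ρ (q + 1) x = partialNorm ρ q x * umap (ρ ^ q) x := by
  simp [partialNorm_apply, Finset.prod_range_succ]

theorem umap_partialNorm {σ ρ : K ≃ₐ[F] K} (h : Commute σ ρ) (q : ℕ) (x : Kˣ) :
    umap σ (partialNorm ρ q x) = partialNorm ρ q (umap σ x) := by
  simp only [partialNorm_apply, map_prod]
  exact Finset.prod_congr rfl fun k _ => umap_comm (h.pow_right k) x

theorem umap_partialNorm_mul (ρ : K ≃ₐ[F] K) (q : ℕ) (x : Kˣ) :
    umap ρ (partialNorm ρ q x) * x = partialNorm ρ q x * umap (ρ ^ q) x := by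
  induction q with
  | zero => simp [partialNorm_apply]
  | succ q ih =>
    rw [partialNorm_succ, map_mul, mul_right_comm, ih, ← umap_mul, ← pow_succ']

theorem partialNorm_mul (ρ : K ≃ₐ[F] K) (q r : ℕ) (x : Kˣ) :
    partialNorm ρ (q * r) x = partialNorm (ρ ^ q) r (partialNorm ρ q x) := by
  induction r with
  | zero => simp [partialNorm_apply]
  | succ r ih =>
    rw [partialNorm_succ, ← ih, umap_partialNorm (((Commute.refl ρ).pow_left q).pow_left r),
      Nat.mul_succ, partialNorm_apply ρ (q * r + q), Finset.prod_range_add,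
      ← partialNorm_apply, partialNorm_apply ρ q]
    congr 1
    refine Finset.prod_congr rfl fun j _ => ?_
    rw [← umap_mul, ← pow_mul, ← pow_add, add_comm]

theorem partialNorm_comm {σ ρ : K ≃ₐ[F] K} (h : Commute σ ρ) (q r : ℕ) (x : Kˣ) :
    partialNorm σ q (partialNorm ρ r x) = partialNorm ρ r (partialNorm σ q x) := by
  rw [partialNorm_apply, partialNorm_apply σ, map_prod]
  exact Finset.prod_congr rfl fun k _ => umap_partialNorm (h.pow_left k) r x

theorem partialNorm_eq_zeta {σ : K ≃ₐ[F] K} {ζ x : Kˣ} (hζ : umap σ ζ = ζ)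
    (h : umap σ x = ζ * x) (q : ℕ) :
    partialNorm σ q x = ζ ^ (∑ j ∈ Finset.range q, j) * x ^ q := by
  simp [partialNorm_apply, umap_pow_eq_zeta hζ h, Finset.prod_mul_distrib,
    ← Finset.prod_pow_eq_pow_sum]

theorem partialNorm_eq_pow {σ : K ≃ₐ[F] K} {x : Kˣ} (h : umap σ x = x) (q : ℕ) :
    partialNorm σ q x = x ^ q := by
  simpa using partialNorm_eq_zeta (ζ := 1) (map_one _) (by simpa using h) q

/-- Conjugates have the same norm. -/
theorem partialNorm_umap_pow {σ : K ≃ₐ[F] K} {q : ℕ} {x : Kˣ} (h : umap (σ ^ q) x = x) (j : ℕ) :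
    partialNorm σ q (umap (σ ^ j) x) = partialNorm σ q x := by
  have h1 := umap_partialNorm_mul σ q x
  rw [h, mul_right_cancel_iff] at h1
  rw [← umap_partialNorm ((Commute.refl σ).pow_left j)]
  exact umap_pow_eq_self h1 j

theorem umap_partialNorm_self {σ : K ≃ₐ[F] K} {q : ℕ} {x : Kˣ} (h : umap (σ ^ q) x = x) :
    umap σ (partialNorm σ q x) = partialNorm σ q x := by
  have h1 := umap_partialNorm_mul σ q x
  rwa [h, mul_right_cancel_iff] at h1

/-- The norm of a double partial product compares `e ^ q` with the norm of `e`. -/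
theorem exists_pow_mul_umap_eq (τ : K ≃ₐ[F] K) (q : ℕ) (e : Kˣ) :
    e ^ q * umap τ (∏ l ∈ Finset.range q, partialNorm τ l e) =
      partialNorm τ q e * ∏ l ∈ Finset.range q, partialNorm τ l e := by
  have h : ∀ l, e * umap τ (partialNorm τ l e) = umap (τ ^ l) e * partialNorm τ l e := fun l => by
    rw [mul_comm, umap_partialNorm_mul, mul_comm]
  rw [map_prod, partialNorm_apply τ q, ← Finset.prod_mul_distrib,
    ← Finset.prod_congr rfl fun l _ => h l, Finset.prod_mul_distrib]
  simp

end Norms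

section HilbertNinety

variable {F K : Type*} [Field F] [Field K] [Algebra F K]

theorem prime_dvd_of_fixes_KiU [IsGalois F K] [FiniteDimensional F K] {p n k : ℕ} (hp : p.Prime)
    {σ : K ≃ₐ[F] K} (horder : orderOf σ = p ^ n) (hk : k < n) {t : ℕ}
    (h : ∀ x ∈ KiU p σ (k + 1), umap (σ ^ (p ^ k * t)) x = x) : p ∣ t := by
  have hmem : σ ^ (p ^ k * t) ∈ Subgroup.zpowers (σ ^ p ^ (k + 1)) := by
    rw [← IntermediateField.fixingSubgroup_fixedField (Subgroup.zpowers (σ ^ p ^ (k + 1))),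
      IntermediateField.mem_fixingSubgroup_iff]
    intro x hx
    by_cases hx0 : x = 0
    · simp [hx0]
    have hfix : (σ ^ p ^ (k + 1)) x = x := hx ⟨_, Subgroup.mem_zpowers _⟩
    exact congrArg Units.val (h (Units.mk0 x hx0) (mem_KiU.2 (Units.ext hfix)))
  obtain ⟨z, hz⟩ := Subgroup.mem_zpowers_iff.1 hmem
  rw [← zpow_natCast, ← zpow_natCast, ← zpow_mul, zpow_eq_zpow_iff_modEq, horder] at hz
  have h1 := hz.dvd
  have h2 : (p : ℤ) ^ (k + 1) ∣ (p : ℤ) ^ k * t := by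
    have h3 : (p : ℤ) ^ (k + 1) ∣ ((p ^ n : ℕ) : ℤ) := by
      push_cast
      exact pow_dvd_pow _ hk
    have h4 := h3.trans h1
    push_cast at h4
    exact (dvd_sub_left (dvd_mul_right _ _)).1 h4
  rw [pow_succ, mul_dvd_mul_iff_left (pow_ne_zero _ (by exact_mod_cast hp.ne_zero))] at h2
  exact_mod_cast h2

/-- Hilbert's Theorem 90 for `K_{k+1}/K_k`. -/
theorem hilbert_ninety [IsGalois F K] [FiniteDimensional F K] {p n k : ℕ} (hp : p.Prime)
    {σ : K ≃ₐ[F] K} (horder : orderOf σ = p ^ n) (hk : k < n) {P : Kˣ}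
    (hP : P ∈ KiU p σ (k + 1)) (hN : partialNorm (σ ^ p ^ k) p P = 1) :
    ∃ β ∈ KiU p σ (k + 1), umap (σ ^ p ^ k) β = P * β := by
  set τ := σ ^ p ^ k with hτ
  have hτp : τ ^ p = σ ^ p ^ (k + 1) := by rw [hτ, ← pow_mul, pow_succ]
  let χ : Fin p → (KiU p σ (k + 1) →* K) := fun j =>
    (Units.coeHom K).comp ((umap (τ ^ (j : ℕ))).comp (KiU p σ (k + 1)).subtype)
  have hχ : Function.Injective χ := by
    intro i j hij
    wlog hle : i ≤ j generalizing i j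
    · exact (this hij.symm (le_of_not_ge hle)).symm
    obtain ⟨t, ht⟩ := Nat.exists_eq_add_of_le (Fin.le_def.1 hle)
    have h1 : ∀ x ∈ KiU p σ (k + 1), umap (σ ^ (p ^ k * t)) x = x := by
      intro x hx
      have h2 : umap (τ ^ (i : ℕ)) x = umap (τ ^ (j : ℕ)) x :=
        Units.ext (DFunLike.congr_fun hij (⟨x, hx⟩ : KiU p σ (k + 1)))
      rw [ht, pow_add, umap_mul] at h2
      rw [pow_mul]
      exact (Units.map_injective (τ ^ (i : ℕ)).injective h2).symm
    have h3 := Nat.eq_zero_of_dvd_of_lt (prime_dvd_of_fixes_KiU hp horder hk h1) (by omega)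
    exact Fin.ext (by omega)
  have hli := (linearIndependent_monoidHom (KiU p σ (k + 1)) K).comp χ hχ
  have hne : ∃ x : KiU p σ (k + 1),
      ∑ j : Fin p, (partialNorm τ j P : K) * χ j x ≠ 0 := by
    by_contra! hcon
    have := Fintype.linearIndependent_iff.1 hli (fun j => (partialNorm τ j P : K)) (by
      ext x
      simpa using hcon x) ⟨0, hp.pos⟩
    exact Units.ne_zero _ this
  obtain ⟨⟨x, hx⟩, hne⟩ := hne
  have hsum : ∑ j : Fin p, (partialNorm τ j P : K) * χ j ⟨x, hx⟩ =
      ∑ j ∈ Finset.range p, ((partialNorm τ j P * umap (τ ^ j) x : Kˣ) : K) := by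
    rw [← Fin.sum_univ_eq_sum_range (fun j => ((partialNorm τ j P * umap (τ ^ j) x : Kˣ) : K))]
    simp [χ]
  rw [hsum] at hne
  set b : Kˣ := Units.mk0 _ hne with hb
  have hcoe : ∀ (ρ : K ≃ₐ[F] K) (u : Kˣ), ρ (u : K) = (umap ρ u : Kˣ) := fun _ _ => rfl
  have hcomm : Commute (σ ^ p ^ (k + 1)) τ := ((Commute.refl σ).pow_left _).pow_right _
  have hfix : b ∈ KiU p σ (k + 1) := by
    rw [mem_KiU]
    ext
    rw [← hcoe, hb, Units.val_mk0, map_sum]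
    refine Finset.sum_congr rfl fun j _ => ?_
    rw [hcoe, map_mul, umap_partialNorm hcomm, umap_comm (hcomm.pow_right j), mem_KiU.1 hP,
      mem_KiU.1 hx]
  have hbP : P * umap τ b = b := by
    ext
    rw [Units.val_mul, ← hcoe, hb, Units.val_mk0, map_sum, Finset.mul_sum]
    have hterm : ∀ j, (P : K) * τ ((partialNorm τ j P * umap (τ ^ j) x : Kˣ) : K) =
        (partialNorm τ (j + 1) P * umap (τ ^ (j + 1)) x : Kˣ) := by
      intro j
      rw [hcoe, ← Units.val_mul, map_mul, ← mul_assoc, mul_comm P, umap_partialNorm_mul,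
        ← partialNorm_succ, ← umap_mul, ← pow_succ']
    rw [Finset.sum_congr rfl fun j _ => hterm j]
    have h1 := Finset.sum_range_succ
      (fun j => ((partialNorm τ j P * umap (τ ^ j) x : Kˣ) : K)) p
    rw [Finset.sum_range_succ', hN, hτp, mem_KiU.1 hx] at h1
    simpa [partialNorm_apply τ 0] using h1
  refine ⟨b⁻¹, inv_mem hfix, ?_⟩
  rw [map_inv]
  nth_rewrite 2 [← hbP]
  rw [mul_inv, mul_inv_cancel_left]

end HilbertNinety

section Descent

variable {F K : Type*} [Field F] [Field K] [Algebra F K]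

/-- An element of `K_{k+1}` whose norm is the `p`-th power of an element of the base field lies
in `K_k` modulo the image of `σ - 1`. -/
theorem exists_mem_KiU_of_normHom_eq_pow [IsGalois F K] [FiniteDimensional F K] {p n k : ℕ}
    (hp : p.Prime) {σ : K ≃ₐ[F] K} (horder : orderOf σ = p ^ n) (hk : k < n) {δ f : Kˣ}
    (hδ : δ ∈ KiU p σ (k + 1)) (hN : normHom p σ (k + 1) δ = f ^ p) (hf : umap σ f = f) :
    ∃ η ∈ KiU p σ k, ∃ β ∈ KiU p σ (k + 1), δ * β = η * umap σ β := by
  set Q := partialNorm σ (p ^ k) with hQ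
  have hP : f⁻¹ * Q δ ∈ KiU p σ (k + 1) := by
    rw [mem_KiU, map_mul, map_inv, umap_pow_eq_self hf, hQ,
      umap_partialNorm ((Commute.refl σ).pow_left _), mem_KiU.1 hδ]
  have hNP : partialNorm (σ ^ p ^ k) p (f⁻¹ * Q δ) = 1 := by
    rw [map_mul, hQ, ← partialNorm_mul, ← pow_succ, ← normHom_eq_partialNorm, hN, map_inv,
      partialNorm_eq_pow (umap_pow_eq_self hf _), inv_mul_cancel]
  obtain ⟨β, hβ, hβP⟩ := hilbert_ninety hp horder hk hP hNP
  refine ⟨δ * β * (umap σ β)⁻¹, ?_, β, hβ, by rw [inv_mul_cancel_right]⟩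
  have h1 := umap_partialNorm_mul σ (p ^ k) β
  rw [hβP, ← hQ, ← mul_assoc, mul_right_cancel_iff] at h1
  have h2 : Q (δ * β * (umap σ β)⁻¹) = f := by
    rw [map_mul, map_mul, map_inv, ← umap_partialNorm (Commute.refl σ), ← hQ, h1]
    rw [mul_inv, mul_inv, inv_inv, mul_assoc, mul_inv_cancel_left, mul_left_comm,
      mul_inv_cancel, mul_one]
  have h3 := umap_partialNorm_mul σ (p ^ k) (δ * β * (umap σ β)⁻¹)
  rw [← hQ, h2, hf, mul_left_cancel_iff] at h3
  exact mem_KiU.2 h3.symm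

theorem prime_dvd_pow_mul_sum_range {p n : ℕ} (hp : p.Prime) (h : p ≠ 2 ∨ 2 ≤ n) :
    p ∣ p ^ (n - 1) * ∑ j ∈ Finset.range p, j := by
  by_cases hn : 2 ≤ n
  · exact (dvd_pow_self p (by omega)).mul_right _
  · have h2 : p ∣ (∑ j ∈ Finset.range p, j) * 2 := by
      rw [Finset.sum_range_id_mul_two]
      exact dvd_mul_right _ _
    have h3 : Nat.Coprime p 2 := (Nat.coprime_primes hp Nat.prime_two).2 (by tauto)
    exact (h3.dvd_of_dvd_mul_right h2).mul_left _

theorem normHom_eq_mul (p : ℕ) (σ : K ≃ₐ[F] K) {n : ℕ} (hn : 0 < n) (x : Kˣ) :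
    normHom p σ n x = partialNorm (σ ^ p ^ (n - 1)) p (partialNorm σ (p ^ (n - 1)) x) := by
  rw [← partialNorm_mul, ← pow_succ, Nat.sub_add_cancel hn, normHom_eq_partialNorm]

theorem normHom_eq_normHom_pred_pow {p n : ℕ} (hp : p.Prime) (hn : 0 < n)
    (hpn : p ≠ 2 ∨ 2 ≤ n) {σ : K ≃ₐ[F] K} {ζ θ : Kˣ} (hζ : umap σ ζ = ζ) (hζp : ζ ^ p = 1)
    (hθ : umap (σ ^ p ^ (n - 1)) θ = ζ * θ) :
    normHom p σ n θ = normHom p σ (n - 1) θ ^ p := by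
  obtain ⟨t, ht⟩ := prime_dvd_pow_mul_sum_range hp hpn
  rw [normHom_eq_mul p σ hn, partialNorm_comm ((Commute.refl σ).pow_left _),
    partialNorm_eq_zeta (umap_pow_eq_self hζ _) hθ, map_mul, map_pow, map_pow,
    partialNorm_eq_pow hζ, ← pow_mul, ht, pow_mul, hζp, one_pow, one_mul, normHom_eq_partialNorm]

/-- The norm of an exceptional element is the `p`-th power of a Kummer generator of `K_1/F`. -/
theorem exists_pow_eq_normHom {p n : ℕ} (hp : p.Prime) (hn : 0 < n)
    {σ : K ≃ₐ[F] K} (hσ : σ ^ p ^ n = 1) {ξ α δ E : Kˣ} (hξσ : umap σ ξ = ξ) (hξp : ξ ^ p = 1)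
    (hα : umap σ α = α * δ * E ^ p) (hξ : ξ = normHom p σ n E * normHom p σ (n - 1) δ)
    (h : p ≠ 2 ∨ 2 ≤ n ∨ δ = 1) :
    ∃ c : Kˣ, c ^ p = normHom p σ n α ∧ umap σ c = ξ * c := by
  set Q := partialNorm σ (p ^ (n - 1)) with hQ
  set τ := σ ^ p ^ (n - 1) with hτ
  have hcomm : Commute σ τ := (Commute.refl σ).pow_right _
  set e := Q E with he
  set f := ∏ l ∈ Finset.range p, partialNorm τ l e with hf
  set s := ∑ j ∈ Finset.range p, j with hs
  have hNσ : ∀ x, umap σ (normHom p σ n x) = normHom p σ n x := fun x =>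
    umap_partialNorm_self (by rw [hσ, umap_one])
  have hQα : umap σ (Q α) = Q α * Q δ * e ^ p := by
    rw [umap_partialNorm (Commute.refl σ), hα, map_mul, map_mul, map_pow]
  have hQf : e ^ p * umap σ (Q f) = Q f * normHom p σ n E := by
    rw [← mul_right_cancel_iff (a := f), mul_assoc, umap_partialNorm_mul, mul_left_comm,
      exists_pow_mul_umap_eq, normHom_eq_mul p σ hn, mul_assoc]
  have hc : umap σ (Q α * Q f) = ξ * (Q α * Q f) := by
    rw [map_mul, hQα, mul_assoc, hQf, hξ, normHom_eq_partialNorm p σ (n - 1), ← hQ]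
    ac_rfl
  have hNf : normHom p σ n f = normHom p σ n E ^ (p ^ (n - 1) * s) := by
    have h1 : normHom p σ n e = normHom p σ n E ^ p ^ (n - 1) := by
      rw [he, normHom_eq_partialNorm, partialNorm_comm (Commute.refl σ),
        ← normHom_eq_partialNorm p σ n,
        partialNorm_eq_pow (hNσ E)]
    have h2 : ∀ l, normHom p σ n (partialNorm τ l e) = normHom p σ n e ^ l := by
      intro l
      rw [partialNorm_apply, map_prod, ← Finset.card_range l, ← Finset.prod_const,
        Finset.card_range]
      refine Finset.prod_congr rfl fun j _ => ?_
      rw [hτ, ← pow_mul]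
      exact partialNorm_umap_pow (by rw [hσ, umap_one]) _
    rw [hf, map_prod, Finset.prod_congr rfl fun l _ => h2 l, Finset.prod_pow_eq_pow_sum, h1,
      pow_mul]
  have key : normHom p σ n α * normHom p σ n E ^ (p ^ (n - 1) * s) =
      ξ ^ (p ^ (n - 1) * s) * (Q α * Q f) ^ p := by
    rw [← hNf, normHom_eq_mul p σ hn, normHom_eq_mul p σ hn, ← map_mul,
      partialNorm_eq_zeta (q := p) (ζ := ξ ^ p ^ (n - 1)) (x := Q α * Q f)
        (by rw [map_pow, umap_pow_eq_self hξσ]) (umap_pow_eq_zeta hξσ hc _), pow_mul]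
  by_cases hpn : p ≠ 2 ∨ 2 ≤ n
  · obtain ⟨t, ht⟩ := prime_dvd_pow_mul_sum_range hp hpn
    refine ⟨Q α * Q f * (normHom p σ n E ^ t)⁻¹, ?_, ?_⟩
    · rw [← hs] at ht
      rw [ht, pow_mul ξ, hξp, one_pow, one_mul, mul_comm p, pow_mul] at key
      rw [mul_pow, ← key, inv_pow, mul_inv_cancel_right]
    · rw [map_mul, hc, map_inv, map_pow, hNσ, mul_assoc]
  · obtain ⟨rfl, hn2⟩ : p = 2 ∧ n = 1 := by push Not at hpn; omega
    subst hn2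
    have hδ : δ = 1 := by tauto
    rw [hδ, map_one, mul_one] at hξ
    refine ⟨Q α * Q f, ?_, hc⟩
    rw [← hξ] at key
    exact (mul_left_cancel ((mul_comm _ _).trans key)).symm

end Descent

section LinearAlgebra

open Polynomial in
/-- A nonzero vector killed by a nonzero polynomial of degree `< p ^ k` in a unipotent operator
of order dividing `p ^ k` is killed by the norm element. -/
theorem sum_pow_apply_eq_zero {p k : ℕ} [Fact p.Prime] {V : Type*} [AddCommGroup V]
    [Module (ZMod p) V] (T : Module.End (ZMod p) V) {v : V} (hv : (T ^ p ^ k) v = v)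
    {c : Fin (p ^ k) → ZMod p} (hc : c ≠ 0) (hsum : ∑ j, c j • (T ^ (j : ℕ)) v = 0) :
    ∑ j ∈ Finset.range (p ^ k), (T ^ j) v = 0 := by
  set f : (ZMod p)[X] := ∑ j : Fin (p ^ k), C (c j) * X ^ (j : ℕ) with hf
  have hcoeff : ∀ j : Fin (p ^ k), f.coeff j = c j := by
    intro j
    simp [hf, coeff_X_pow, Fin.val_inj]
  have hf0 : f ≠ 0 := by
    rintro h0
    refine hc (funext fun j => ?_)
    rw [← hcoeff, h0, coeff_zero, Pi.zero_apply]
  have hdeg : f.natDegree < p ^ k := by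
    rw [natDegree_lt_iff_degree_lt hf0]
    refine (degree_sum_le _ _).trans_lt ((Finset.sup_lt_iff ?_).2 fun j _ => ?_)
    · exact WithBot.bot_lt_coe _
    · exact (degree_C_mul_X_pow_le _ _).trans_lt (by exact_mod_cast j.2)
  obtain ⟨g, hg, hgX⟩ := exists_eq_pow_rootMultiplicity_mul_and_not_dvd f hf0 1
  have hr : f.rootMultiplicity 1 < p ^ k := by
    refine lt_of_le_of_lt ?_ hdeg
    rw [← count_roots]
    exact (Multiset.count_le_card _ _).trans (card_roots' f)
  set r := f.rootMultiplicity 1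
  have hcop : IsCoprime ((X - C 1 : (ZMod p)[X]) ^ p ^ k) g :=
    (((irreducible_X_sub_C 1).coprime_iff_not_dvd).2 hgX).pow_left
  obtain ⟨u, w, huw⟩ := hcop
  have hX : (X - C 1 : (ZMod p)[X]) ^ p ^ k = X ^ p ^ k - 1 := by
    rw [C_1, sub_pow_char_pow, one_pow]
  have hgeom : ∑ j ∈ Finset.range (p ^ k), (X : (ZMod p)[X]) ^ j = (X - C 1) ^ (p ^ k - 1) := by
    refine mul_right_cancel₀ (X_sub_C_ne_zero (1 : ZMod p)) ?_
    rw [← pow_succ, Nat.sub_add_cancel (by omega), hX, C_1, geom_sum_mul]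
  have hid : ∑ j ∈ Finset.range (p ^ k), (X : (ZMod p)[X]) ^ j =
      (X - C 1) ^ (p ^ k - 1) * u * (X ^ p ^ k - 1) + (X - C 1) ^ (p ^ k - 1 - r) * w * f := by
    rw [hgeom, ← hX, hg]
    calc (X - C 1 : (ZMod p)[X]) ^ (p ^ k - 1)
        = (X - C 1) ^ (p ^ k - 1) * (u * (X - C 1) ^ p ^ k + w * g) := by rw [huw, mul_one]
      _ = _ := by
        rw [show p ^ k - 1 = (p ^ k - 1 - r) + r by omega, pow_add, Nat.add_sub_cancel]
        ring
  have h1 := congrArg (fun q => aeval T q v) hid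
  simp only [map_sum, map_add, map_mul, map_sub, map_pow, aeval_X, map_one, LinearMap.add_apply,
    Module.End.mul_apply, LinearMap.sum_apply, LinearMap.sub_apply, Module.End.one_apply, hv,
    sub_self, map_zero, zero_add] at h1
  rw [h1]
  have h2 : aeval T f v = 0 := by
    rw [← hsum, hf, map_sum, LinearMap.sum_apply]
    simp
  rw [h2, map_zero, map_zero]

theorem sum_iterate_eq_zero {p k : ℕ} [Fact p.Prime] {V : Type*} [AddCommGroup V]
    [Module (ZMod p) V] (T : V →+ V) {v : V} (hv : T^[p ^ k] v = v)
    {c : Fin (p ^ k) → ZMod p} (hc : c ≠ 0) (hsum : ∑ j, (c j).val • T^[(j : ℕ)] v = 0) :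
    ∑ j ∈ Finset.range (p ^ k), T^[j] v = 0 := by
  let T' : Module.End (ZMod p) V := T.toZModLinearMap p
  have hT : ∀ j : ℕ, (T' ^ j) v = T^[j] v := fun j => Module.End.pow_apply T' j v
  simp only [← hT] at hv hsum ⊢
  refine sum_pow_apply_eq_zero _ hv hc ?_
  rw [← hsum]
  refine Finset.sum_congr rfl fun j _ => ?_
  rw [← Nat.cast_smul_eq_nsmul (ZMod p), ZMod.natCast_zmod_val]

variable {F K : Type*} [Field F] [Field K] [Algebra F K]

/-- If the conjugates of `δ ∈ K_k` are dependent modulo `p`-th powers, then the norm of `δ` is a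
`p`-th power. -/
theorem exists_pow_eq_normHom_of_not_freeCyc {p k : ℕ} (hp : p.Prime) {σ : K ≃ₐ[F] K} {δ : Kˣ}
    (hδ : δ ∈ KiU p σ k) (h : ¬ FreeCyc p σ k δ) : ∃ c : Kˣ, c ^ p = normHom p σ k δ := by
  have : Fact p.Prime := ⟨hp⟩
  have hfix := mem_KiU.1 hδ
  obtain ⟨c, hc, hc0⟩ : ∃ c : Fin (p ^ k) → ZMod p,
      (∏ j : Fin (p ^ k), jcls p (umap (σ ^ (j : ℕ)) δ) ^ (c j).val) = 1 ∧ c ≠ 0 := by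
    by_contra! hcon
    exact h ⟨by rw [hfix], hcon⟩
  have hexp : ∀ x : Additive (Kˣ ⧸ powSub K p), p • x = 0 := by
    intro x
    obtain ⟨y, hy⟩ := QuotientGroup.mk_surjective x.toMul
    have h1 : x.toMul ^ p = 1 := by
      rw [← hy, ← QuotientGroup.mk_pow, QuotientGroup.eq_one_iff]
      exact ⟨y, rfl⟩
    exact congrArg Additive.ofMul h1
  have hT : ∀ j : ℕ, (MonoidHom.toAdditive (jmap p σ))^[j] (Additive.ofMul (jcls p δ)) =
      Additive.ofMul (jcls p (umap (σ ^ j) δ)) := by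
    intro j
    induction j with
    | zero => simp
    | succ j ih =>
      rw [Function.iterate_succ_apply', ih, pow_succ', umap_mul]
      rfl
  let := AddCommGroup.zmodModule (G := Additive (Kˣ ⧸ powSub K p)) hexp
  have h1 := sum_iterate_eq_zero (p := p) (k := k) (MonoidHom.toAdditive (jmap p σ))
    (v := Additive.ofMul (jcls p δ)) (by rw [hT, hfix]) hc0 (by
      rw [← ofMul_one, ← hc, ofMul_prod]
      refine Finset.sum_congr rfl fun j _ => ?_
      rw [hT, ofMul_pow])
  rw [Finset.sum_congr rfl fun j _ => hT j, ← ofMul_prod, ofMul_eq_zero] at h1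
  have h2 : (QuotientGroup.mk (normHom p σ k δ) : Kˣ ⧸ powSub K p) = 1 := by
    rw [normHom_eq_partialNorm, partialNorm_apply, ← h1]
    exact map_prod (QuotientGroup.mk' (powSub K p)) _ _
  exact (QuotientGroup.eq_one_iff _).1 h2

end LinearAlgebra

section Minimality

variable {F K : Type*} [Field F] [Field K] [Algebra F K]

theorem IsMinimalNormPair.not_vecLT {p n m : ℕ} {σ : K ≃ₐ[F] K} {ξ : Kˣ}
    {a a' : Fin m → WithBot ℕ} {d d' : ℤ} (hmin : IsMinimalNormPair p n σ ξ a d)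
    (h : IsNormPair p n σ ξ a' d') : ¬ vecLT a' a := by
  rintro ⟨k, hk, hlt⟩
  obtain ⟨l, hl, hlt'⟩ | ⟨rfl, -⟩ := hmin.2 a' d' h
  · rcases lt_trichotomy k l with hkl | rfl | hkl
    · exact hlt.ne (hl k hkl).symm
    · exact hlt.asymm hlt'
    · exact hlt'.ne (hk l hkl).symm
  · exact hlt.ne rfl

/-- The vector agreeing with `a` before `i`, with value `b` at `i`, and maximal after `i`. -/
def lowerAt (n : ℕ) {m : ℕ} (a : Fin m → WithBot ℕ) (i : Fin m) (b : WithBot ℕ) :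
    Fin m → WithBot ℕ :=
  fun j => if j < i then a j else if j = i then b else (n : WithBot ℕ)

theorem vecLT_lowerAt (n : ℕ) {m : ℕ} {a : Fin m → WithBot ℕ} {i : Fin m} {b : WithBot ℕ}
    (hb : b < a i) : vecLT (lowerAt n a i b) a :=
  ⟨i, fun j hj => by simp [lowerAt, hj], by simpa [lowerAt] using hb⟩

theorem levelMem_top {p n : ℕ} {σ : K ≃ₐ[F] K} (hσ : σ ^ p ^ n = 1) (x : Kˣ) :
    levelMem p σ (n : WithBot ℕ) x :=
  show x ∈ KiU p σ n from mem_KiU.2 (by rw [hσ, umap_one])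

theorem twist_identity {G : Type*} [CommGroup G] {A A' S D B B' H T : G} {P Q : ℕ} {d x y : ℤ}
    (hd : d + Q * y - 1 = P * x) (hA : A' = A ^ d * S) (hD : D * B = A ^ y * H * B' * T ^ P) :
    A' * (B' ^ Q)⁻¹ =
      (A * (B ^ Q)⁻¹) ^ (d + Q * y) * (S * ((H / D) ^ Q * (T * B ^ x) ^ (Q * P))) := by
  obtain rfl : d = P * x + 1 - Q * y := by linear_combination hd
  obtain rfl : D = A ^ y * H * B' * T ^ P * B⁻¹ := eq_mul_inv_of_mul_eq hD
  rw [hA]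
  apply Additive.ofMul.injective
  simp only [ofMul_mul, ofMul_inv, ofMul_zpow, ofMul_pow, ofMul_div]
  module

theorem norm_identity {G : Type*} [CommGroup G] {A B C D H S T : G} {P R : ℕ} {x y : ℤ}
    (hD : D * B = A ^ y * H * B * T ^ P) :
    A ^ x * C * S = (A * (B ^ (R * P))⁻¹) ^ (x + R * y) * C *
      (S * ((H / D) ^ R * (T ^ (R * P) * (B ^ (x + R * y)) ^ (R * P)))) := by
  obtain rfl : D = A ^ y * H * B * T ^ P * B⁻¹ := eq_mul_inv_of_mul_eq hD
  apply Additive.ofMul.injective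
  simp only [ofMul_mul, ofMul_inv, ofMul_zpow, ofMul_pow, ofMul_div]
  module

theorem norm_identity_zero {G : Type*} [CommGroup G] {A B B' D H S T : G} {x : ℤ}
    (hD : D * B' = H * B' * T) :
    A ^ x * D * S = (A * B⁻¹) ^ x * H * (S * (T * B ^ x)) := by
  obtain rfl : D = H * B' * T * B'⁻¹ := eq_mul_inv_of_mul_eq hD
  apply Additive.ofMul.injective
  simp only [ofMul_mul, ofMul_inv, ofMul_zpow]
  module

/-- A representation of `(a, d)` can be modified by `α ↦ α β^{-p^i}`, `d ↦ d + p^i y` so that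
`δ_i` is replaced by `η` when `δ_i β = α^y η σ(β) θ^p`; by minimality the level of `η` cannot be
smaller than `a_i`. -/
theorem IsMinimalNormPair.not_levelMem {p n m : ℕ} (hp : p.Prime) {σ : K ≃ₐ[F] K}
    (hσ : σ ^ p ^ n = 1) {ξ : Kˣ} {a : Fin m → WithBot ℕ} {d : ℤ} {α : Kˣ} {δ : ℕ → Kˣ}
    (hmin : IsMinimalNormPair p n σ ξ a d) (hrep : Represents p n σ ξ a d α δ) {i : Fin m}
    {b : WithBot ℕ} (hb : b < a i) {y : ℤ} {η β θ : Kˣ}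
    (hδ : δ i * β = α ^ y * η * umap σ β * θ ^ p)
    (h0 : (i : ℕ) = 0 → y = 0 ∧ umap (σ ^ p ^ (n - 1)) β = β ∧
      normHom p σ n θ = normHom p σ (n - 1) θ ^ p) :
    ¬ levelMem p σ b η := by
  intro hη
  obtain ⟨⟨han, ha0, hd, -⟩, -⟩ := id hmin
  obtain ⟨hlev, hα, hξ⟩ := hrep
  obtain ⟨x, hx⟩ := hd
  have hp0 : (p : ℤ) ≠ 0 := by exact_mod_cast hp.ne_zero
  obtain ⟨z, hz⟩ : ∃ z : ℤ, (p : ℤ) ^ (i : ℕ) * y = p * z ∧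
      (0 < (i : ℕ) → z = (p : ℤ) ^ ((i : ℕ) - 1) * y) := by
    by_cases hi : (i : ℕ) = 0
    · exact ⟨0, by simp [(h0 hi).1], fun h => by omega⟩
    · refine ⟨(p : ℤ) ^ ((i : ℕ) - 1) * y, ?_, fun _ => rfl⟩
      rw [← mul_assoc, ← pow_succ', Nat.sub_add_cancel (by omega)]
  obtain ⟨hz, hz'⟩ := hz
  have hx' : (d + (p : ℤ) ^ (i : ℕ) * y - 1) = p * (x + z) := by rw [hz]; linear_combination hx
  set ε : ℕ → Kˣ := fun j => Pi.mulSingle (M := fun _ : ℕ => Kˣ) (i : ℕ) (η / δ i) j *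
    Pi.mulSingle (M := fun _ : ℕ => Kˣ) ((i : ℕ) + 1) (θ * β ^ (x + z)) j with hε
  have hεi : ε i = η / δ i := by simp [hε, Pi.mulSingle_apply]
  have hεlt : ∀ j < (i : ℕ), ε j = 1 := fun j hj => by
    simp [hε, Pi.mulSingle_apply, hj.ne, show j ≠ i + 1 by omega]
  have hprod : ∀ (f : ℕ → Kˣ →* Kˣ) (s : Finset ℕ), (i : ℕ) + 1 ∈ s →
      ∏ j ∈ s, f j (ε j) =
        (if (i : ℕ) ∈ s then f i (η / δ i) else 1) * f (i + 1) (θ * β ^ (x + z)) := by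
    intro f s hs
    have h1 : ∀ (k : ℕ) (u : Kˣ) (j : ℕ), f j (Pi.mulSingle (M := fun _ : ℕ => Kˣ) k u j) =
        if j = k then f k u else 1 := by
      intro k u j
      by_cases h : j = k
      · subst h; simp
      · simp [h]
    simp only [hε, map_mul (f _), h1, Finset.prod_mul_distrib, Finset.prod_ite_eq', if_pos hs]
  refine hmin.not_vecLT (d' := d + (p : ℤ) ^ (i : ℕ) * y) ?_ (vecLT_lowerAt n hb)
  refine ⟨fun j => ?_, fun hm => ?_, ⟨_, hx'⟩, α * (β ^ p ^ (i : ℕ))⁻¹, fun j => δ j * ε j,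
    fun j => ?_, ?_, ?_⟩
  · unfold lowerAt
    split_ifs with h1 h2
    · exact han j
    · exact hb.le.trans (han i)
    · exact le_rfl
  · unfold lowerAt
    split_ifs with h1 h2
    · exact ha0 hm
    · subst h2
      exact hb.trans (ha0 hm)
    · exact absurd (Fin.ext (by simpa [Fin.lt_def, eq_comm] using h1) : (⟨0, hm⟩ : Fin m) = i) h2
  · unfold lowerAt
    split_ifs with h1 h2
    · beta_reduce
      rw [hεlt j h1, mul_one]
      exact hlev j
    · beta_reduce
      rw [h2, hεi, mul_div_cancel]
      exact hη
    · exact levelMem_top hσ _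
  · have h1 := hprod (fun j => powMonoidHom (p ^ j)) (Finset.range (m + 1))
      (by simp [Finset.mem_range])
    simp only [powMonoidHom_apply] at h1
    rw [if_pos (by simp [Finset.mem_range])] at h1
    simp only [mul_pow, Finset.prod_mul_distrib]
    rw [h1, map_mul, map_inv, map_pow, pow_succ p]
    have := twist_identity (Q := p ^ (i : ℕ)) (by exact_mod_cast hx') hα hδ
    exact_mod_cast this
  · have h1 := hprod (fun j => (powMonoidHom (p ^ (j - 1))).comp (normHom p σ n))
      (Finset.Icc 1 m) (by simp)
    simp only [MonoidHom.comp_apply, powMonoidHom_apply, Nat.add_sub_cancel] at h1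
    simp only [map_mul (normHom p σ n), mul_pow, Finset.prod_mul_distrib]
    simp only [map_mul (normHom p σ n), mul_pow] at h1
    rw [h1, hx', Int.mul_ediv_cancel_left _ hp0]
    rw [hx, Int.mul_ediv_cancel_left _ hp0] at hξ
    by_cases hi : (i : ℕ) = 0
    · obtain ⟨rfl, hβ, hθ⟩ := h0 hi
      obtain rfl : z = 0 := by simpa [hp.ne_zero] using hz.symm
      rw [hi] at hεi hδ
      have h2 := congrArg (normHom p σ (n - 1)) hδ
      have h3 : normHom p σ (n - 1) (umap σ β) = normHom p σ (n - 1) β := by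
        exact partialNorm_umap_pow hβ 1
      simp only [map_mul, zpow_zero, one_mul, map_pow, h3, ← hθ] at h2
      rw [hi, hεi, mul_div_cancel, hξ]
      rw [if_neg (by simp)]
      simp only [pow_zero, pow_one, add_zero, one_mul, map_zpow, map_inv]
      exact norm_identity_zero h2
    · rw [hεlt 0 (by omega), mul_one, if_pos (by simp; omega), hξ]
      have h2 := congrArg (normHom p σ n) hδ
      have h3 : normHom p σ n (umap σ β) = normHom p σ n β := by
        exact partialNorm_umap_pow (q := p ^ n) (x := β) (by rw [hσ, umap_one]) 1
      simp only [map_mul, map_zpow, map_pow, h3] at h2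
      rw [hz' (by omega)]
      simp only [map_inv, map_pow, map_zpow, map_div]
      obtain ⟨r, hr⟩ : ∃ r, (i : ℕ) = r + 1 := ⟨(i : ℕ) - 1, by omega⟩
      rw [hr] at h2
      rw [hr, pow_succ p r, Nat.add_sub_cancel]
      exact_mod_cast norm_identity (R := p ^ r) h2

end Minimality

section Freeness

variable {F K : Type*} [Field F] [Field K] [Algebra F K]

theorem exists_mem_KiU_umap_eq_mul [IsGalois F K] [FiniteDimensional F K] {p n k : ℕ}
    (hp : p.Prime) {σ : K ≃ₐ[F] K} (horder : orderOf σ = p ^ n) (hk : k < n) {ξ : Kˣ}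
    (hξσ : umap σ ξ = ξ) (hξp : ξ ^ p = 1) :
    ∃ θ ∈ KiU p σ (k + 1), umap (σ ^ p ^ k) θ = ξ * θ := by
  have hfix := umap_pow_eq_self hξσ
  exact hilbert_ninety hp horder hk (mem_KiU.2 (hfix _)) (by rw [partialNorm_eq_pow (hfix _), hξp])

/-- If `[K : F] = p` and `ξ` is a norm, then the first entry of a minimal norm pair is `-∞`. -/
theorem IsMinimalNormPair.eq_bot [IsGalois F K] [FiniteDimensional F K] {p m : ℕ}
    (hp : p.Prime) (hm : 0 < m) {σ : K ≃ₐ[F] K} (horder : orderOf σ = p ^ 1) {ξ γ : Kˣ}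
    (hξp : ξ ^ p = 1) (hγ : normHom p σ 1 γ = ξ) {a : Fin m → WithBot ℕ} {d : ℤ}
    (hmin : IsMinimalNormPair p 1 σ ξ a d) : a ⟨0, hm⟩ = ⊥ := by
  have hσ : σ ^ p ^ 1 = 1 := horder ▸ pow_orderOf_eq_one σ
  obtain ⟨β, -, hβ⟩ := hilbert_ninety hp horder one_pos (P := γ ^ p)
    (levelMem_top hσ _) (by
      rw [pow_zero, pow_one, map_pow]
      rw [normHom_eq_partialNorm, pow_one] at hγ
      rw [hγ, hξp])
  rw [pow_zero, pow_one] at hβ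
  by_contra hbot
  refine hmin.not_vecLT (d' := 1) ?_ (vecLT_lowerAt 1 (bot_lt_iff_ne_bot.2 hbot))
  refine ⟨fun j => ?_, fun _ => by simp [lowerAt], by simp, β,
    Pi.mulSingle (M := fun _ : ℕ => Kˣ) 1 γ, fun j => ?_, ?_, ?_⟩
  · unfold lowerAt
    split_ifs with h1 h2
    · exact hmin.1.1 j
    · exact bot_le
    · exact le_rfl
  · unfold lowerAt
    split_ifs with h1 h2
    · exact absurd h1 (by simp [Fin.lt_def])
    · subst h2
      exact Pi.mulSingle_eq_of_ne (by simp) _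
    · exact levelMem_top hσ _
  · rw [Finset.prod_eq_single 1 (fun j _ hj => by simp [hj]) (by simp; omega)]
    simp [hβ, mul_comm]
  · rw [Finset.prod_eq_single 1 (fun j _ hj => by simp [hj]) (by simp; omega)]
    simp [hγ]

theorem IsMinimalNormPair.ne_pow {p n m : ℕ} (hp : p.Prime) (hn : 0 < n)
    {σ : K ≃ₐ[F] K} (hσ : σ ^ p ^ n = 1) {ξ : Kˣ} (hξσ : umap σ ξ = ξ) (hξp : ξ ^ p = 1)
    {a : Fin m → WithBot ℕ} {d : ℤ} {α : Kˣ} {δ : ℕ → Kˣ}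
    (hmin : IsMinimalNormPair p n σ ξ a d) (hrep : Represents p n σ ξ a d α δ) {i : Fin m}
    (hi : a i ≠ ⊥) (hpn : (i : ℕ) = 0 → p ≠ 2 ∨ 2 ≤ n) {c : Kˣ} {y : ℕ}
    (hc : umap σ c = ξ ^ y * c) : c ^ p ≠ δ i := by
  intro h
  refine hmin.not_levelMem hp hσ hrep (bot_lt_iff_ne_bot.2 hi) (y := 0) (η := 1) (β := 1) (θ := c)
    (by simp [h]) (fun h0 => ⟨rfl, map_one _, ?_⟩) rfl
  have hζ : umap σ (ξ ^ y) = ξ ^ y := by rw [map_pow, hξσ]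
  refine normHom_eq_normHom_pred_pow hp hn (hpn h0) (ζ := (ξ ^ y) ^ p ^ (n - 1))
    (by rw [map_pow, hζ]) ?_ (umap_pow_eq_zeta hζ hc _)
  rw [pow_right_comm _ _ p, pow_right_comm ξ, hξp, one_pow, one_pow]

theorem IsMinimalNormPair.normHom_ne_pow [IsGalois F K] [FiniteDimensional F K] {p n m k : ℕ}
    (hp : p.Prime) {σ : K ≃ₐ[F] K} (horder : orderOf σ = p ^ n) (hk : k + 1 < n) {ξ : Kˣ}
    (hξσ : umap σ ξ = ξ) (hξp : ξ ^ p = 1)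
    {a : Fin m → WithBot ℕ} {d : ℤ} {α : Kˣ} {δ : ℕ → Kˣ}
    (hmin : IsMinimalNormPair p n σ ξ a d) (hrep : Represents p n σ ξ a d α δ) {i : Fin m}
    (hi : a i = (k + 1 : ℕ)) (hδ : δ i ∈ KiU p σ (k + 1)) {c : Kˣ} {y : ℕ}
    (hc : umap σ c = ξ ^ y * c) : c ^ p ≠ normHom p σ (k + 1) (δ i) := by
  intro h
  have hσ : σ ^ p ^ n = 1 := horder ▸ pow_orderOf_eq_one σ
  obtain ⟨θ, hθ, hθξ⟩ := exists_mem_KiU_umap_eq_mul hp horder hk hξσ hξp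
  set c' := normHom p σ (k + 1) θ with hc'
  have hc'σ : umap σ c' = ξ * c' := by
    have := umap_partialNorm_mul σ (p ^ (k + 1)) θ
    rw [hθξ, ← mul_assoc, mul_right_cancel_iff] at this
    rw [hc', normHom_eq_partialNorm, this, mul_comm]
  have hθp : θ ^ p ∈ KiU p σ (k + 1) := by
    rw [mem_KiU, map_pow, hθξ, mul_pow, hξp, one_mul]
  obtain ⟨η, hη, β, hβ, hδβ⟩ := exists_mem_KiU_of_normHom_eq_pow hp horder
    (k := k) (by omega) (δ := δ i * ((θ ^ p) ^ y)⁻¹) (f := c * (c' ^ y)⁻¹)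
    (mul_mem hδ (inv_mem (pow_mem hθp _)))
    (by rw [map_mul, map_inv, map_pow, map_pow, ← hc', ← h, mul_pow, inv_pow, pow_right_comm])
    (by
      rw [map_mul, map_inv, map_pow, hc, hc'σ, mul_pow, mul_inv, mul_mul_mul_comm,
        mul_inv_cancel, one_mul])
  refine hmin.not_levelMem hp hσ hrep (b := k) (y := 0) (η := η) (β := β) (θ := θ ^ y)
    (by rw [hi]; exact_mod_cast k.lt_succ_self) ?_ (fun h0 => ⟨rfl, ?_, ?_⟩) hη
  · rw [zpow_zero, one_mul, ← hδβ, pow_right_comm, mul_right_comm, inv_mul_cancel_right]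
  · exact mem_KiU.1 (KiU_mono (by omega) σ hβ)
  · have h1 := umap_pow_eq_zeta (umap_pow_eq_self hξσ _) hθξ (p ^ (n - 1 - (k + 1)))
    rw [← pow_mul, ← pow_add, Nat.add_sub_cancel' (by omega)] at h1
    refine normHom_eq_normHom_pred_pow hp (by omega) (Or.inr (by omega))
      (ζ := (ξ ^ p ^ (n - 1 - (k + 1))) ^ y) (by rw [map_pow, map_pow, hξσ]) ?_
      (by rw [map_pow, h1, mul_pow])
    rw [pow_right_comm _ _ p, pow_right_comm ξ, hξp, one_pow, one_pow]

/-- The norm of `α` is a `p`-th power in `K` whose `p`-th root is a Kummer generator over `F`. -/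
theorem Represents.exists_pow_eq_normHom {p n m : ℕ} (hp : p.Prime) (hn : 0 < n)
    {σ : K ≃ₐ[F] K} (hσ : σ ^ p ^ n = 1) {ξ : Kˣ} (hξσ : umap σ ξ = ξ) (hξp : ξ ^ p = 1)
    {a : Fin m → WithBot ℕ} {d : ℤ} (hd : (p : ℤ) ∣ d - 1) {α : Kˣ} {δ : ℕ → Kˣ}
    (hrep : Represents p n σ ξ a d α δ) (h : p ≠ 2 ∨ 2 ≤ n ∨ δ 0 = 1) :
    ∃ c : Kˣ, c ^ p = normHom p σ n α ∧ umap σ c = ξ * c := by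
  obtain ⟨-, hα, hξ⟩ := hrep
  obtain ⟨x, hx⟩ := hd
  rw [hx, Int.mul_ediv_cancel_left _ (by exact_mod_cast hp.ne_zero)] at hξ
  obtain rfl : d = 1 + p * x := by linear_combination hx
  refine MSS.exists_pow_eq_normHom hp hn hσ hξσ hξp (δ := δ 0)
    (E := α ^ x * ∏ j ∈ Finset.Icc 1 m, δ j ^ p ^ (j - 1)) ?_ ?_ h
  · rw [hα, Finset.prod_range_succ', pow_zero, pow_one, mul_pow, ← Finset.prod_pow,
      zpow_add, zpow_one, mul_comm (p : ℤ), zpow_mul, zpow_natCast,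
      ← Finset.Ico_add_one_right_eq_Icc, Finset.prod_Ico_eq_prod_range]
    have : ∀ j, δ (j + 1) ^ p ^ (j + 1) = (δ (1 + j) ^ p ^ (1 + j - 1)) ^ p := fun j => by
      rw [← pow_mul, ← pow_succ, add_comm 1 j, Nat.add_sub_cancel]
    simp only [this, Nat.add_sub_cancel]
    simp only [mul_comm, mul_left_comm, mul_assoc]
  · rw [map_mul, map_zpow, map_prod]
    simp only [map_pow]
    rw [mul_right_comm]
    exact hξ

theorem IsMinimalNormPair.normHom_ne_pow_top [IsGalois F K] [FiniteDimensional F K] {p n m : ℕ}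
    (hp : p.Prime) (hn : 0 < n) {σ : K ≃ₐ[F] K} (horder : orderOf σ = p ^ n) {ξ : Kˣ}
    (hξσ : umap σ ξ = ξ) (hξp : ξ ^ p = 1)
    {a : Fin m → WithBot ℕ} {d : ℤ} {α : Kˣ} {δ : ℕ → Kˣ}
    (hmin : IsMinimalNormPair p n σ ξ a d) (hrep : Represents p n σ ξ a d α δ)
    (h0 : p ≠ 2 ∨ 2 ≤ n ∨ δ 0 = 1) {i : Fin m} (hi : a i = n) {c : Kˣ} {y : ℕ}
    (hc : umap σ c = ξ ^ y * c) : c ^ p ≠ normHom p σ n (δ i) := by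
  intro h
  obtain ⟨k, rfl⟩ : ∃ k, n = k + 1 := ⟨n - 1, by omega⟩
  have hσ : σ ^ p ^ (k + 1) = 1 := horder ▸ pow_orderOf_eq_one σ
  obtain ⟨c', hc', hc'σ⟩ := hrep.exists_pow_eq_normHom hp hn hσ hξσ hξp hmin.1.2.2.1 h0
  obtain ⟨η, hη, β, -, hδβ⟩ := exists_mem_KiU_of_normHom_eq_pow hp horder
    (k := k) (by omega) (δ := δ i * (α ^ y)⁻¹) (f := c * (c' ^ y)⁻¹)
    (levelMem_top hσ _)
    (by rw [map_mul, map_inv, map_pow, ← hc', ← h, mul_pow, inv_pow, pow_right_comm])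
    (by
      rw [map_mul, map_inv, map_pow, hc, hc'σ, mul_pow, mul_inv, mul_mul_mul_comm,
        mul_inv_cancel, one_mul])
  refine hmin.not_levelMem hp hσ hrep (b := k) (y := y) (η := η) (β := β) (θ := 1)
    (by rw [hi]; exact_mod_cast k.lt_succ_self) ?_ (fun hi0 => ?_) hη
  · rw [zpow_natCast, one_pow, mul_one, mul_assoc, ← hδβ, mul_right_comm, mul_inv_cancel_comm_assoc]
  · have hlt := hmin.1.2.1 i.pos
    rw [show (⟨0, i.pos⟩ : Fin m) = i from Fin.ext hi0.symm] at hlt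
    exact absurd hi hlt.ne

end Freeness

end MSS

universe u v

/-- **Proposition.**  Suppose `(α, {δ_i})` represents a minimal norm pair
`(a, d)` of length `m`.  Then for every `0 ≤ i < m` with `a_i ≠ -∞`, the cyclic
`F_p[G]`-submodule of `J_1` generated by `[δ_i]_1` is a free
`F_p[G_{a_i}]`-module. -/
theorem statement_14 {F : Type u} {K : Type v} [Field F] [Field K] [Algebra F K]
    [IsGalois F K] [FiniteDimensional F K]
    (p n m : ℕ) (hp : p.Prime) (hn : 0 < n) (hm : 0 < m)
    (σ : K ≃ₐ[F] K) (horder : orderOf σ = p ^ n)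
    (hgen : ∀ τ : K ≃ₐ[F] K, τ ∈ Subgroup.zpowers σ)
    (ξ : Kˣ) (hξ : IsPrimitiveRoot (ξ : K) p)
    (hξF : (ξ : K) ∈ Set.range (algebraMap F K))
    (hspecial : p = 2 → n = 1 → ∃ γ : Kˣ, MSS.normHom p σ n γ = -1)
    (a : Fin m → WithBot ℕ) (d : ℤ) (α : Kˣ) (δ : ℕ → Kˣ)
    (hmin : MSS.IsMinimalNormPair p n σ ξ a d)
    (hrep : MSS.Represents p n σ ξ a d α δ) :
    ∀ (i : Fin m) (k : ℕ), a i = (k : WithBot ℕ) → MSS.FreeCyc p σ k (δ i) := by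

  intro i k hi
  have hσ : σ ^ p ^ n = 1 := horder ▸ pow_orderOf_eq_one σ
  have hξ' : IsPrimitiveRoot ξ p := IsPrimitiveRoot.coe_units_iff.1 hξ
  have hξp : ξ ^ p = 1 := hξ'.pow_eq_one
  have hξσ : MSS.umap σ ξ = ξ := by
    obtain ⟨z, hz⟩ := hξF
    ext
    change σ (ξ : K) = ξ
    rw [← hz, AlgEquiv.commutes]
  have hδ : ∀ (j : Fin m) (l : ℕ), a j = l → δ j ∈ MSS.KiU p σ l := fun j l hj => by
    simpa [hj] using! hrep.1 j
  have hbot : p ≠ 2 ∨ 2 ≤ n ∨ a ⟨0, hm⟩ = ⊥ := by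
    by_cases hpn : p ≠ 2 ∨ 2 ≤ n
    · tauto
    · obtain ⟨rfl, rfl⟩ : p = 2 ∧ n = 1 := by omega
      obtain ⟨γ, hγ⟩ := hspecial rfl rfl
      refine Or.inr (Or.inr (hmin.eq_bot hp hm horder hξp (hγ.trans ?_)))
      ext
      exact hξ.eq_neg_one_of_two_right.symm
  by_contra hfree
  obtain ⟨c, hc⟩ := MSS.exists_pow_eq_normHom_of_not_freeCyc hp (hδ i k hi) hfree
  obtain ⟨y, hy⟩ : ∃ y : ℕ, MSS.umap σ c = ξ ^ y * c := by
    have : NeZero p := ⟨hp.ne_zero⟩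
    have h1 : MSS.umap σ (c ^ p) = c ^ p := by
      rw [hc, MSS.normHom_eq_partialNorm]
      exact MSS.umap_partialNorm_self (MSS.mem_KiU.1 (hδ i k hi))
    obtain ⟨y, -, hy⟩ := hξ.eq_pow_of_pow_eq_one (ξ := ((MSS.umap σ c / c : Kˣ) : K)) (by
      rw [← Units.val_pow_eq_pow_val, div_pow, ← map_pow, h1, div_self', Units.val_one])
    refine ⟨y, ?_⟩
    rw [← Units.val_pow_eq_pow_val, Units.val_inj] at hy
    rw [hy, div_mul_cancel]
  have hkn : k ≤ n := by
    have := hmin.1.1 i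
    rw [hi] at this
    exact_mod_cast this
  have h0 : (i : ℕ) = 0 → p ≠ 2 ∨ 2 ≤ n := fun h => by
    obtain rfl : i = ⟨0, hm⟩ := Fin.ext h
    simpa [hi] using hbot
  obtain rfl | hlt := hkn.eq_or_lt
  · refine hmin.normHom_ne_pow_top hp hn horder hξσ hξp hrep ?_ hi hy hc
    refine hbot.imp_right (Or.imp_right fun h => ?_)
    simpa [h] using! hrep.1 ⟨0, hm⟩
  · cases k with
    | zero =>
      refine hmin.ne_pow hp hn hσ hξσ hξp hrep (by simp [hi]) h0 hy (hc.trans ?_)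
      simp [MSS.normHom]
    | succ k => exact hmin.normHom_ne_pow hp horder hlt hξσ hξp hrep hi (hδ i _ hi) hy hc
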